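/- Let X be a Hausdorff topological space with a countable k-network and let Y be a topological space with the strong Pytkeev property at a point e ∈ Y. Then C_k(X,Y), the space of continuous maps from X to Y with the compact-open topology, has the strong Pytkeev property at the constant function with value e. -/

import Mathlib

open Set Filter Topology

/-- A set `A` accumulates at a point `x` if every neighborhood of `x`
contains infinitely many points of `A`. -/
def Accumulates {X : Type*} [TopologicalSpace X] (A : Set X) (x : X) : Prop :=
  ∀ O ∈ 𝓝 x, (O ∩ A).Infinite

/-- A family `𝒩` of subsets is a Pytkeev network at `x`. -/
def IsPytkeevNetworkAt {X : Type*} [TopologicalSpace X] (𝒩 : Set (Set X)) (x : X) : Prop :=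
  ∀ O ∈ 𝓝 x, ∀ A : Set X, Accumulates A x → ∃ N ∈ 𝒩, N ⊆ O ∧ (N ∩ A).Infinite

/-- `X` has the strong Pytkeev property at `x`. -/
def StrongPytkeevAt (X : Type*) [TopologicalSpace X] (x : X) : Prop :=
  ∃ 𝒩 : Set (Set X), 𝒩.Countable ∧ IsPytkeevNetworkAt 𝒩 x

/-- A family `𝒩` of subsets of `X` is a k-network: for every open `U` and compact
`K ⊆ U` there is a finite subfamily `ℱ ⊆ 𝒩` with `K ⊆ ⋃₀ ℱ ⊆ U`. -/
def IsKNetwork {X : Type*} [TopologicalSpace X] (𝒩 : Set (Set X)) : Prop :=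
  ∀ U : Set X, IsOpen U → ∀ K : Set X, IsCompact K → K ⊆ U →
    ∃ ℱ ⊆ 𝒩, ℱ.Finite ∧ K ⊆ ⋃₀ ℱ ∧ ⋃₀ ℱ ⊆ U

/-- A set with `e` in its closure accumulates at `e` if it misses the intersection of all
neighborhoods of `e`. -/
theorem accumulates_of_mem_closure {Y : Type*} [TopologicalSpace Y] {e : Y} {B : Set Y}
    (hB : e ∈ closure B) (hker : Disjoint B (𝓝 e).ker) : Accumulates B e := by
  intro W hW hfin
  have hsep : ∀ b ∈ W ∩ B, ∃ V ∈ 𝓝 e, b ∉ V := by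
    intro b hb
    have : b ∉ (𝓝 e).ker := disjoint_left.1 hker hb.2
    simpa [Filter.mem_ker] using this
  choose! V hV hbV using hsep
  obtain ⟨b, hb, hbB⟩ := mem_closure_iff_nhds.1 hB _
    (inter_mem hW ((biInter_mem hfin).2 hV))
  exact hbV b ⟨hb.1, hbB⟩ (mem_iInter₂.1 hb.2 b ⟨hb.1, hbB⟩)

theorem StrongPytkeevAt.exists_monotone_seq {Y : Type*} [TopologicalSpace Y] {e : Y}
    (hY : StrongPytkeevAt Y e) :
    ∃ 𝒩 : Set (Set Y), 𝒩.Countable ∧ ∀ U ∈ 𝓝 e, ∃ M : ℕ → Set Y, Monotone M ∧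
      (∀ n, M n ∈ 𝒩) ∧ (∀ n, M n ⊆ U) ∧ (∀ n, (𝓝 e).ker ⊆ M n) ∧
      ∀ B : Set Y, Accumulates B e → ∃ n, (M n ∩ B).Infinite := by
  obtain ⟨𝒩, h𝒩, hnet⟩ := hY
  have hcount := countable_ofPred_finite_subset (h𝒩.insert ∅)
  refine ⟨(fun F : Set (Set Y) ↦ (𝓝 e).ker ∪ ⋃₀ F) '' _, hcount.image _, fun U hU ↦ ?_⟩
  have hS : (insert ∅ {N ∈ 𝒩 | N ⊆ U}).Countable := (h𝒩.mono (sep_subset _ _)).insert ∅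
  obtain ⟨ν, hν⟩ := hS.exists_eq_range (insert_nonempty _ _)
  have hνmem : ∀ i, ν i ∈ insert ∅ {N ∈ 𝒩 | N ⊆ U} := fun i ↦ hν ▸ mem_range_self i
  refine ⟨fun n ↦ (𝓝 e).ker ∪ ⋃₀ (ν '' Iic n), ?_, ?_, ?_, fun n ↦ subset_union_left, ?_⟩
  · intro m n hmn
    exact union_subset_union_right _ (sUnion_mono (image_mono (Iic_subset_Iic.2 hmn)))
  · refine fun n ↦ ⟨ν '' Iic n, ⟨(finite_Iic n).image _, ?_⟩, rfl⟩
    rintro _ ⟨i, -, rfl⟩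
    exact (hνmem i).imp id And.left
  · refine fun n ↦ union_subset (fun y hy ↦ Filter.mem_ker.1 hy U hU) (sUnion_subset ?_)
    rintro _ ⟨i, -, rfl⟩
    rcases hνmem i with h | h
    · simp [h]
    · exact h.2
  · intro B hB
    obtain ⟨N, hN, hNU, hinf⟩ := hnet U hU B hB
    obtain ⟨i, rfl⟩ : N ∈ range ν := hν ▸ Or.inr ⟨hN, hNU⟩
    refine ⟨i, hinf.mono (inter_subset_inter_left _ ?_)⟩
    exact (subset_sUnion_of_mem (mem_image_of_mem ν self_mem_Iic)).trans subset_union_right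

/-- Countable tightness at a point with the strong Pytkeev property. -/
theorem StrongPytkeevAt.exists_seq_mem_closure {Y : Type*} [TopologicalSpace Y] {e : Y}
    (hY : StrongPytkeevAt Y e) {P : Set Y} (hP : e ∈ closure P) :
    ∃ p : ℕ → Y, (∀ i, p i ∈ P) ∧ e ∈ closure (range p) := by
  by_cases hker : Disjoint P (𝓝 e).ker
  · obtain ⟨𝒩, h𝒩, hnet⟩ := hY
    have hacc := accumulates_of_mem_closure hP hker
    have hS : {N ∈ 𝒩 | (N ∩ P).Nonempty}.Countable := h𝒩.mono (sep_subset _ _)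
    have hne : {N ∈ 𝒩 | (N ∩ P).Nonempty}.Nonempty := by
      obtain ⟨N, hN, -, hinf⟩ := hnet univ univ_mem P hacc
      exact ⟨N, hN, hinf.nonempty⟩
    obtain ⟨ν, hν⟩ := hS.exists_eq_range hne
    have hνmem : ∀ i, (ν i ∩ P).Nonempty := fun i ↦
      ((hν ▸ mem_range_self i : ν i ∈ {N ∈ 𝒩 | (N ∩ P).Nonempty})).2
    choose p hpν hpP using hνmem
    refine ⟨p, hpP, mem_closure_iff_nhds.2 fun W hW ↦ ?_⟩
    obtain ⟨N, hN, hNW, hinf⟩ := hnet W hW P hacc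
    obtain ⟨i, rfl⟩ : N ∈ range ν := hν ▸ ⟨hN, hinf.nonempty⟩
    exact ⟨p i, hNW (hpν i), mem_range_self i⟩
  · obtain ⟨y, hyP, hy⟩ := not_disjoint_iff.1 hker
    exact ⟨fun _ ↦ y, fun _ ↦ hyP, mem_closure_iff_nhds.2 fun W hW ↦
      ⟨y, Filter.mem_ker.1 hy W hW, mem_range_self 0⟩⟩

theorem IsKNetwork.exists_antitone_seq {X : Type*} [TopologicalSpace X] {𝒦 : Set (Set X)}
    (hknet : IsKNetwork 𝒦) (h𝒦 : 𝒦.Countable) :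
    ∃ 𝒦' : Set (Set X), 𝒦'.Countable ∧ ∀ C : Set X, IsCompact C → ∃ K : ℕ → Set X,
      Antitone K ∧ (∀ n, K n ∈ 𝒦') ∧ (∀ n, C ⊆ K n) ∧
      ∀ V : Set X, IsOpen V → C ⊆ V → ∃ n, K n ⊆ V := by
  have h𝒰 := (countable_ofPred_finite_subset h𝒦).image sUnion
  set 𝒰 := sUnion '' {ℱ : Set (Set X) | ℱ.Finite ∧ ℱ ⊆ 𝒦}
  refine ⟨sInter '' _, (countable_ofPred_finite_subset h𝒰).image sInter, fun C hC ↦ ?_⟩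
  have hex : ∀ V : Set X, IsOpen V → C ⊆ V → ∃ L ∈ {L ∈ 𝒰 | C ⊆ L}, L ⊆ V := by
    intro V hV hCV
    obtain ⟨ℱ, hℱ, hfin, hCℱ, hℱV⟩ := hknet V hV C hC hCV
    exact ⟨⋃₀ ℱ, ⟨⟨ℱ, ⟨hfin, hℱ⟩, rfl⟩, hCℱ⟩, hℱV⟩
  have hne : {L ∈ 𝒰 | C ⊆ L}.Nonempty :=
    let ⟨L, hL, _⟩ := hex univ isOpen_univ (subset_univ _)
    ⟨L, hL⟩
  obtain ⟨κ, hκ⟩ := (h𝒰.mono (sep_subset _ fun L ↦ C ⊆ L)).exists_eq_range hne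
  have hκmem : ∀ i, κ i ∈ {L ∈ 𝒰 | C ⊆ L} := fun i ↦ hκ ▸ mem_range_self i
  refine ⟨fun n ↦ ⋂₀ (κ '' Iic n), ?_, ?_, ?_, ?_⟩
  · exact fun m n hmn ↦ sInter_subset_sInter (image_mono (Iic_subset_Iic.2 hmn))
  · refine fun n ↦ ⟨κ '' Iic n, ⟨(finite_Iic n).image _, ?_⟩, rfl⟩
    rintro _ ⟨i, -, rfl⟩
    exact (hκmem i).1
  · refine fun n ↦ subset_sInter ?_
    rintro _ ⟨i, -, rfl⟩
    exact (hκmem i).2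
  · intro V hV hCV
    obtain ⟨L, hL, hLV⟩ := hex V hV hCV
    obtain ⟨i, rfl⟩ : L ∈ range κ := hκ ▸ hL
    exact ⟨i, (sInter_subset_of_mem (mem_image_of_mem κ self_mem_Iic)).trans hLV⟩

theorem IsCompact.union_of_finite_diff {X : Type*} [TopologicalSpace X] {C S : Set X}
    (hC : IsCompact C) (hS : ∀ V : Set X, IsOpen V → C ⊆ V → (S \ V).Finite) :
    IsCompact (C ∪ S) := by
  refine isCompact_of_finite_subcover fun {ι} U hU hcover ↦ ?_
  classical
  obtain ⟨t, ht⟩ := hC.elim_finite_subcover U hU (subset_union_left.trans hcover)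
  obtain ⟨t', ht'⟩ := (hS _ (isOpen_biUnion fun i _ ↦ hU i) ht).isCompact.elim_finite_subcover U hU
    (sdiff_subset.trans (subset_union_right.trans hcover))
  refine ⟨t ∪ t', ?_⟩
  rw [Finset.set_biUnion_union]
  rintro x (hx | hx)
  · exact Or.inl (ht hx)
  · exact or_iff_not_imp_left.2 fun h ↦ ht' ⟨hx, h⟩

/-- A sequence with terms in sets shrinking to a compact set has a cluster point in it. -/
theorem IsCompact.exists_mapClusterPt_of_shrinking {X : Type*} [TopologicalSpace X] {C : Set X}
    (hC : IsCompact C) {K : ℕ → Set X} (hK : Antitone K)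
    (hKC : ∀ V : Set X, IsOpen V → C ⊆ V → ∃ n, K n ⊆ V) {x : ℕ → X} (hx : ∀ n, x n ∈ K n) :
    ∃ z ∈ C, MapClusterPt z atTop x := by
  by_contra! h
  have hloc : ∀ z ∈ C, ∃ V, IsOpen V ∧ z ∈ V ∧ ∀ᶠ n in atTop, x n ∉ V := by
    intro z hz
    have := h z hz
    rw [mapClusterPt_iff_frequently] at this
    push Not at this
    obtain ⟨s, hs, hev⟩ := this
    obtain ⟨V, hVs, hV, hzV⟩ := mem_nhds_iff.1 hs
    exact ⟨V, hV, hzV, hev.mono fun n hn hnV ↦ hn (hVs hnV)⟩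
  choose! V hV hzV hev using hloc
  obtain ⟨t, htC, ht⟩ := hC.elim_nhds_subcover V fun z hz ↦ (hV z hz).mem_nhds (hzV z hz)
  obtain ⟨m, hm⟩ := hKC _ (isOpen_biUnion fun z hz ↦ hV z (htC z hz)) ht
  have hall : ∀ᶠ n in atTop, ∀ z ∈ t, x n ∉ V z :=
    (Filter.eventually_all_finset t).2 fun z hz ↦ hev z (htC z hz)
  obtain ⟨n, hn, hmn⟩ := (hall.and (eventually_ge_atTop m)).exists
  obtain ⟨z, hz, hxz⟩ := mem_iUnion₂.1 (hm (hK hmn (hx n)))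
  exact hn z hz hxz

theorem exists_mapsTo_subset_of_mem_nhds_const {X Y : Type*} [TopologicalSpace X]
    [TopologicalSpace Y] {e : Y} {O : Set C(X, Y)} (hO : O ∈ 𝓝 (ContinuousMap.const X e)) :
    ∃ C : Set X, IsCompact C ∧ ∃ U ∈ 𝓝 e, {f : C(X, Y) | MapsTo f C U} ⊆ O := by
  obtain ⟨S, hS, hSmem, hSO⟩ := ContinuousMap.mem_nhds_iff.1 hO
  refine ⟨⋃ p ∈ S, p.1, hS.isCompact_biUnion fun p hp ↦ (hSmem p.1 p.2 hp).1,
    ⋂ p ∈ S, {y | p.1.Nonempty → y ∈ p.2}, (biInter_mem hS).2 fun p hp ↦ ?_, ?_⟩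
  · obtain ⟨-, hU, hmaps⟩ := hSmem p.1 p.2 hp
    by_cases hne : p.1.Nonempty
    · filter_upwards [hU.mem_nhds (hmaps hne.some_mem)] with y hy _ using hy
    · exact univ_mem' fun y hy ↦ absurd hy hne
  · refine fun f hf ↦ hSO fun K U hKU x hx ↦ ?_
    exact mem_iInter₂.1 (hf (mem_biUnion hKU hx)) (K, U) hKU ⟨x, hx⟩

theorem mapsTo_mem_nhds_const {X Y : Type*} [TopologicalSpace X] [TopologicalSpace Y] {e : Y}
    {C : Set X} (hC : IsCompact C) {W : Set Y} (hW : W ∈ 𝓝 e) :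
    {f : C(X, Y) | MapsTo f C W} ∈ 𝓝 (ContinuousMap.const X e) :=
  (ContinuousMap.eventually_mapsTo hC isOpen_interior fun _ _ ↦
    mem_interior_iff_mem_nhds.2 hW).mono fun _ hf ↦ hf.mono_right interior_subset

section Witnesses

variable {X Y : Type*} [TopologicalSpace X] [TopologicalSpace Y] {e : Y} {C : Set X}
  {K : ℕ → Set X} {M : ℕ → Set Y} {A : Set C(X, Y)}

/-- If only finitely many members of `A` map `K n` into `M n` for each `n`, then those that do so
for some `n` do not accumulate at the constant map. -/
theorem not_accumulates_of_eventually_mapsTo (hC : IsCompact C) (hK : Antitone K)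
    (hKC : ∀ V : Set X, IsOpen V → C ⊆ V → ∃ n, K n ⊆ V) (hM : Monotone M)
    (hker : ∀ n, (𝓝 e).ker ⊆ M n)
    (hMinf : ∀ B : Set Y, Accumulates B e → ∃ n, (M n ∩ B).Infinite)
    (hfin : ∀ n, {f ∈ A | MapsTo f (K n) (M n)}.Finite) :
    ¬ Accumulates {f ∈ A | ∃ n, MapsTo f (K n) (M n)} (ContinuousMap.const X e) := by
  intro hacc
  set D := {f ∈ A | (∃ n, MapsTo f (K n) (M n)) ∧ ¬ MapsTo f (K 0) (M 0)}
  have hmono : ∀ {f : C(X, Y)} {m n : ℕ}, m ≤ n → MapsTo f (K m) (M m) → MapsTo f (K n) (M n) :=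
    fun hmn h ↦ h.mono (hK hmn) (hM hmn)
  have hlast : ∀ f ∈ D, ∃ n, MapsTo f (K (n + 1)) (M (n + 1)) ∧ ∃ x ∈ K n, f x ∉ M n := by
    rintro f ⟨-, hex, h0⟩
    classical
    obtain ⟨n, hn⟩ : ∃ n, Nat.find hex = n + 1 :=
      Nat.exists_eq_succ_of_ne_zero fun h ↦ h0 (h ▸ Nat.find_spec hex)
    refine ⟨n, hn ▸ Nat.find_spec hex, ?_⟩
    have := Nat.find_min hex (m := n) (by omega)
    simpa [MapsTo] using this
  have : Nonempty X := by
    obtain ⟨f, ⟨-, hfA, hfex⟩, hf0⟩ := ((hacc univ univ_mem).sdiff (hfin 0)).nonempty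
    obtain ⟨-, -, x, -⟩ := hlast f ⟨hfA, hfex, fun h ↦ hf0 ⟨hfA, h⟩⟩
    exact ⟨x⟩
  choose! n hn x hxK hxM using hlast
  have hDfin : ∀ m, {f ∈ D | n f < m}.Finite := fun m ↦ (hfin m).subset fun f hf ↦
    ⟨hf.1.1, hmono hf.2 (hn f hf.1)⟩
  have hC' : IsCompact (C ∪ x '' D) := by
    refine hC.union_of_finite_diff fun V hV hCV ↦ ?_
    obtain ⟨m, hm⟩ := hKC V hV hCV
    refine ((hDfin m).image x).subset ?_
    rintro _ ⟨⟨f, hf, rfl⟩, hfV⟩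
    exact ⟨f, ⟨hf, not_le.1 fun h ↦ hfV (hm (hK h (hxK f hf)))⟩, rfl⟩
  have hB : Accumulates ((fun f : C(X, Y) ↦ f (x f)) '' D) e := by
    refine accumulates_of_mem_closure (mem_closure_iff_nhds.2 fun W hW ↦ ?_) ?_
    · obtain ⟨f, ⟨hfW, hfA, hfex⟩, hf0⟩ :=
        ((hacc _ (mapsTo_mem_nhds_const hC' hW)).sdiff (hfin 0)).nonempty
      have hfD : f ∈ D := ⟨hfA, hfex, fun h ↦ hf0 ⟨hfA, h⟩⟩
      exact ⟨f (x f), hfW (Or.inr (mem_image_of_mem x hfD)), f, hfD, rfl⟩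
    · rw [disjoint_left]
      rintro _ ⟨f, hf, rfl⟩ h
      exact hxM f hf (hker _ h)
  obtain ⟨m, hm⟩ := hMinf _ hB
  refine hm (((hDfin m).image fun f : C(X, Y) ↦ f (x f)).subset ?_)
  rintro _ ⟨hfM, f, hf, rfl⟩
  exact ⟨f, ⟨hf, not_le.1 fun h ↦ hxM f hf (hM h hfM)⟩, rfl⟩

/-- The maps sending no `K n` into the corresponding `M n` cannot approximate the constant map
on `C`. -/
theorem exists_nhds_forall_exists_mapsTo (hY : StrongPytkeevAt Y e) (hC : IsCompact C)
    (hK : Antitone K) (hKC : ∀ V : Set X, IsOpen V → C ⊆ V → ∃ n, K n ⊆ V) (hM : Monotone M)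
    (hker : ∀ n, (𝓝 e).ker ⊆ M n)
    (hMinf : ∀ B : Set Y, Accumulates B e → ∃ n, (M n ∩ B).Infinite) :
    ∃ W ∈ 𝓝 e, ∀ f : C(X, Y), MapsTo f C W → ∃ n, MapsTo f (K n) (M n) := by
  by_contra! h
  set D := {f : C(X, Y) | ∀ n, ¬ MapsTo f (K n) (M n)}
  have hwit : ∀ f ∈ D, ∀ n, ∃ x ∈ K n, f x ∉ M n := fun f hf n ↦ by
    simpa [MapsTo] using hf n
  have : Nonempty X := by
    obtain ⟨f, -, hf⟩ := h univ univ_mem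
    exact ⟨(hwit f hf 0).choose⟩
  choose! x hxK hxM using hwit
  have hclus : ∀ f ∈ D, ∃ z ∈ C, MapClusterPt z atTop (x f) := fun f hf ↦
    hC.exists_mapClusterPt_of_shrinking hK hKC (hxK f hf)
  choose! z hzC hz using hclus
  have hP : e ∈ closure ((fun f : C(X, Y) ↦ f (z f)) '' D) := by
    refine mem_closure_iff_nhds.2 fun W hW ↦ ?_
    obtain ⟨f, hfW, hf⟩ := h W hW
    exact ⟨f (z f), hfW (hzC f hf), f, hf, rfl⟩
  obtain ⟨p, hpP, hp⟩ := hY.exists_seq_mem_closure hP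
  choose f hfD hfp using hpP
  have hB : Accumulates {y | ∃ i n, i ≤ n ∧ f i (x (f i) n) = y} e := by
    refine accumulates_of_mem_closure (mem_closure_iff_nhds.2 fun W hW ↦ ?_) ?_
    · obtain ⟨_, hW', i, rfl⟩ := mem_closure_iff_nhds.1 hp _ (interior_mem_nhds.2 hW)
      have hnhds : f i ⁻¹' W ∈ 𝓝 (z (f i)) :=
        (f i).continuous.continuousAt.preimage_mem_nhds
          (mem_interior_iff_mem_nhds.1 (by rwa [← hfp i] at hW'))
      obtain ⟨n, hnW, hin⟩ := ((mapClusterPt_iff_frequently.1 (hz _ (hfD i)) _ hnhds).and_eventually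
        (eventually_ge_atTop i)).exists
      exact ⟨_, hnW, i, n, hin, rfl⟩
    · rw [disjoint_left]
      rintro _ ⟨i, n, -, rfl⟩ h
      exact hxM _ (hfD i) n (hker n h)
  obtain ⟨m, hm⟩ := hMinf _ hB
  refine hm ((((finite_Iio m).prod (finite_Iio m)).image
    fun q : ℕ × ℕ ↦ f q.1 (x (f q.1) q.2)).subset ?_)
  rintro _ ⟨hyM, i, n, hin, rfl⟩
  have hnm : n < m := not_le.1 fun h ↦ hxM _ (hfD i) n (hM h hyM)
  exact ⟨(i, n), ⟨hin.trans_lt hnm, hnm⟩, rfl⟩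

end Witnesses

/-- For a Hausdorff space `X` with a countable k-network and a space `Y` with the strong
Pytkeev property at `e`, the function space `C_k(X,Y)` (continuous maps with the
compact-open topology) has the strong Pytkeev property at the constant function
with value `e`. -/
theorem strongPytkeevAt_compactOpen {X Y : Type*} [TopologicalSpace X] [T2Space X]
    [TopologicalSpace Y]
    (𝒦 : Set (Set X)) (h𝒦 : 𝒦.Countable) (hknet : IsKNetwork 𝒦)
    (e : Y) (hY : StrongPytkeevAt Y e) :
    StrongPytkeevAt C(X, Y) (ContinuousMap.const X e) := by
  obtain ⟨𝒦', h𝒦', hseqK⟩ := hknet.exists_antitone_seq h𝒦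
  obtain ⟨𝒩, h𝒩, hseqM⟩ := hY.exists_monotone_seq
  refine ⟨image2 (fun K M ↦ {f : C(X, Y) | MapsTo f K M}) 𝒦' 𝒩, h𝒦'.image2 h𝒩 _, ?_⟩
  intro O hO A hA
  obtain ⟨C, hC, U, hU, hCUO⟩ := exists_mapsTo_subset_of_mem_nhds_const hO
  obtain ⟨K, hK, hK𝒦, hCK, hKC⟩ := hseqK C hC
  obtain ⟨M, hM, hM𝒩, hMU, hker, hMinf⟩ := hseqM U hU
  by_cases hinf : ∃ n, ({f : C(X, Y) | MapsTo f (K n) (M n)} ∩ A).Infinite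
  · obtain ⟨n, hn⟩ := hinf
    exact ⟨_, mem_image2_of_mem (hK𝒦 n) (hM𝒩 n),
      fun f hf ↦ hCUO (hf.mono (hCK n) (hMU n)), hn⟩
  · exfalso
    obtain ⟨W, hW, hWex⟩ := exists_nhds_forall_exists_mapsTo hY hC hK hKC hM hker hMinf
    refine not_accumulates_of_eventually_mapsTo (A := A) hC hK hKC hM hker hMinf (fun n ↦ ?_)
      fun V hV ↦ ?_
    · exact (not_infinite.1 fun h ↦ hinf ⟨n, h⟩).subset fun f hf ↦ ⟨hf.2, hf.1⟩
    · exact (hA _ (inter_mem hV (mapsTo_mem_nhds_const hC hW))).mono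
        fun f hf ↦ ⟨hf.1.1, hf.2, hWex f hf.1.2⟩
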